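/- For every positive integer m, the achievement number of the matching with m edges satisfies a(mK_2) = 5 if m = 2, and a(mK_2) = 2m if m = 1 or m ≥ 3. -/

import Mathlib

namespace AchievementGame

/-- A strategy for the achievement game: given the history of all moves played so far
(earliest first), produce the next move (an edge, i.e. an element of `Sym2`). -/
def Strategy (α : Type*) : Type _ := List (Sym2 α) → Sym2 α

/-- A strategy is valid for the host graph `G` if, whenever some edge of `G` is still
uncolored, it chooses an uncolored edge of `G`. -/
def Strategy.Valid {α : Type*} (G : SimpleGraph α) (s : Strategy α) : Prop :=
  ∀ l : List (Sym2 α), (∃ e ∈ G.edgeSet, e ∉ l) → s l ∈ G.edgeSet ∧ s l ∉ l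

/-- The history of the first `n` moves when Alice plays strategy `σ` and Bob plays
strategy `τ`; Alice moves first and the players alternate. -/
def hist {α : Type*} (σ τ : Strategy α) : ℕ → List (Sym2 α)
  | 0 => []
  | n + 1 => hist σ τ n ++ [(if n % 2 = 0 then σ else τ) (hist σ τ n)]

/-- The `n`-th move (0-indexed): even indices are Alice's (blue) moves,
odd indices are Bob's (red) moves. -/
def move {α : Type*} (σ τ : Strategy α) (n : ℕ) : Sym2 α :=
  (if n % 2 = 0 then σ else τ) (hist σ τ n)

/-- The set `s` of edges contains a copy of the graph `F`. -/
def HasCopy {α β : Type*} (F : SimpleGraph β) (s : Set (Sym2 α)) : Prop :=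
  ∃ f : β ↪ α, ∀ a b, F.Adj a b → s(f a, f b) ∈ s

/-- Alice has a winning strategy in the achievement game `(F, G, +)`: Alice has a valid
strategy such that against every valid strategy of Bob, at some legal move of Alice
(her `(k+1)`-st move, which exists since `2k+1 ≤ |E(G)|`) the blue edges contain a copy
of `F`, while the red edges played strictly before do not. -/
def AliceWins {α β : Type*} (F : SimpleGraph β) (G : SimpleGraph α) : Prop :=
  ∃ σ : Strategy α, Strategy.Valid G σ ∧ ∀ τ : Strategy α, Strategy.Valid G τ →
    ∃ k : ℕ, 2 * k + 1 ≤ G.edgeSet.ncard ∧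
      HasCopy F {e | ∃ i ≤ k, e = move σ τ (2 * i)} ∧
      ¬ HasCopy F {e | ∃ i < k, e = move σ τ (2 * i + 1)}

/-- The matching `mK₂` consisting of `m` pairwise disjoint edges. -/
def matching (m : ℕ) : SimpleGraph (Fin m ⊕ Fin m) :=
  SimpleGraph.fromRel (fun a b => ∃ i, a = Sum.inl i ∧ b = Sum.inr i)

/-- The star `K_{1,m}`: the center `0` joined to `m` leaves. -/
def star (m : ℕ) : SimpleGraph (Fin (m + 1)) :=
  SimpleGraph.fromRel (fun a _ => a = 0)

/-- The double star `S_{m,n}`: disjoint stars `K_{1,m}` and `K_{1,n}` with an edge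
joining their centers `Sum.inl 0` and `Sum.inr 0`. -/
def doubleStar (m n : ℕ) : SimpleGraph (Fin (m + 1) ⊕ Fin (n + 1)) :=
  SimpleGraph.fromRel (fun a b =>
    (a = Sum.inl 0 ∧ ∃ i, b = Sum.inl i) ∨
    (a = Sum.inr 0 ∧ ∃ j, b = Sum.inr j) ∨
    (a = Sum.inl 0 ∧ b = Sum.inr 0))

/-- The disjoint union `K_{1,m} ∪ nK₂` of a star and a matching. -/
def starMatching (m n : ℕ) : SimpleGraph (Fin (m + 1) ⊕ (Fin n ⊕ Fin n)) :=
  SimpleGraph.fromRel (fun a b =>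
    (a = Sum.inl 0 ∧ ∃ i, b = Sum.inl i) ∨
    (∃ i, a = Sum.inr (Sum.inl i) ∧ b = Sum.inr (Sum.inr i)))

end AchievementGame

open AchievementGame

namespace AchievementGame

/-- `e` is an uncolored edge. -/
def Free {α : Type*} (G : SimpleGraph α) (B R : Set (Sym2 α)) (e : Sym2 α) : Prop :=
  e ∈ G.edgeSet ∧ e ∉ B ∧ e ∉ R

/-- Positions (blue set, red set), Alice to move, from which she can force a win. -/
inductive Win {α β : Type*} (F : SimpleGraph β) (G : SimpleGraph α) :
    Set (Sym2 α) → Set (Sym2 α) → Prop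
  | now (B R : Set (Sym2 α)) (e : Sym2 α) : Free G B R e → HasCopy F (insert e B) →
      ¬ HasCopy F R → Win F G B R
  | later (B R : Set (Sym2 α)) (e : Sym2 α) : Free G B R e → (∃ f, Free G (insert e B) R f) →
      (∀ f, Free G (insert e B) R f → Win F G (insert e B) (insert f R)) → Win F G B R

def Good {α β : Type*} (F : SimpleGraph β) (G : SimpleGraph α) (B R : Set (Sym2 α))
    (e : Sym2 α) : Prop :=
  Free G B R e ∧ ((HasCopy F (insert e B) ∧ ¬ HasCopy F R) ∨
    ((∃ f, Free G (insert e B) R f) ∧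
      ∀ f, Free G (insert e B) R f → Win F G (insert e B) (insert f R)))

theorem Win.good {α β : Type*} {F : SimpleGraph β} {G : SimpleGraph α} {B R : Set (Sym2 α)}
    (h : Win F G B R) : ∃ e, Good F G B R e := by
  cases h with
  | now _ _ e h1 h2 h3 => exact ⟨e, h1, Or.inl ⟨h2, h3⟩⟩
  | later _ _ e h1 h2 h3 => exact ⟨e, h1, Or.inr ⟨h2, h3⟩⟩

def bl {α : Type*} (l : List (Sym2 α)) : Set (Sym2 α) := {e | ∃ i, l[2 * i]? = some e}
def rd {α : Type*} (l : List (Sym2 α)) : Set (Sym2 α) := {e | ∃ i, l[2 * i + 1]? = some e}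

theorem mem_iff_bl_rd {α : Type*} (l : List (Sym2 α)) (e : Sym2 α) :
    e ∈ l ↔ e ∈ bl l ∨ e ∈ rd l := by
  rw [List.mem_iff_getElem?]
  constructor
  · rintro ⟨j, hj⟩
    rcases Nat.even_or_odd' j with ⟨i, rfl | rfl⟩
    · exact Or.inl ⟨i, hj⟩
    · exact Or.inr ⟨i, hj⟩
  · rintro (⟨i, h⟩ | ⟨i, h⟩) <;> exact ⟨_, h⟩

theorem hist_length {α : Type*} (σ τ : Strategy α) (n : ℕ) : (hist σ τ n).length = n := by
  induction n with
  | zero => rfl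
  | succ n ih => simp [hist, ih]

theorem hist_succ {α : Type*} (σ τ : Strategy α) (n : ℕ) :
    hist σ τ (n + 1) = hist σ τ n ++ [move σ τ n] := rfl

theorem hist_get {α : Type*} (σ τ : Strategy α) (n i : ℕ) :
    (hist σ τ n)[i]? = if i < n then some (move σ τ i) else none := by
  induction n with
  | zero => simp [hist]
  | succ n ih =>
    rw [hist_succ, List.getElem?_append, hist_length, ih]
    rcases lt_trichotomy i n with h | h | h
    · simp [h, Nat.lt_succ_of_lt h]
    · subst h; simp
    · have h1 : ¬ i < n := by omega
      have h2 : ¬ i < n + 1 := by omega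
      have h3 : i - n ≠ 0 := by omega
      simp [h1, h2, h3]

theorem mem_hist {α : Type*} (σ τ : Strategy α) (n i : ℕ) (h : i < n) :
    move σ τ i ∈ hist σ τ n := by
  rw [List.mem_iff_getElem?]
  exact ⟨i, by simp [hist_get, h]⟩

theorem bl_hist_even {α : Type*} (σ τ : Strategy α) (k : ℕ) :
    bl (hist σ τ (2 * k)) = {e | ∃ i < k, e = move σ τ (2 * i)} := by
  ext e
  simp only [bl, hist_get, Set.mem_ofPred_eq]
  constructor
  · rintro ⟨i, h⟩
    split_ifs at h with h'
    exact ⟨i, by omega, by simpa using h.symm⟩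
  · rintro ⟨i, h, rfl⟩
    exact ⟨i, by rw [if_pos (by omega)]⟩

theorem rd_hist_even {α : Type*} (σ τ : Strategy α) (k : ℕ) :
    rd (hist σ τ (2 * k)) = {e | ∃ i < k, e = move σ τ (2 * i + 1)} := by
  ext e
  simp only [rd, hist_get, Set.mem_ofPred_eq]
  constructor
  · rintro ⟨i, h⟩
    split_ifs at h with h'
    exact ⟨i, by omega, by simpa using h.symm⟩
  · rintro ⟨i, h, rfl⟩
    exact ⟨i, by rw [if_pos (by omega)]⟩

theorem set_lt_succ {γ : Type*} (g : ℕ → γ) (k : ℕ) :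
    {e | ∃ i < k + 1, e = g i} = insert (g k) {e | ∃ i < k, e = g i} := by
  ext e
  simp only [Set.mem_ofPred_eq, Set.mem_insert_iff]
  constructor
  · rintro ⟨i, h, rfl⟩
    rcases Nat.lt_succ_iff_lt_or_eq.1 h with h | rfl
    · exact Or.inr ⟨i, h, rfl⟩
    · exact Or.inl rfl
  · rintro (rfl | ⟨i, h, rfl⟩)
    · exact ⟨k, by omega, rfl⟩
    · exact ⟨i, by omega, rfl⟩

theorem nodup_le {α : Type*} [Finite α] (G : SimpleGraph α) (l : List (Sym2 α)) (hn : l.Nodup)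
    (h : ∀ e ∈ l, e ∈ G.edgeSet) : l.length ≤ G.edgeSet.ncard := by
  classical
  rw [← List.toFinset_card_of_nodup hn, ← Set.ncard_coe_finset]
  exact Set.ncard_le_ncard (by intro e he; exact h e (by simpa using he)) (Set.toFinite _)

theorem Win.aliceWins {α β : Type*} [Finite α] {F : SimpleGraph β} {G : SimpleGraph α}
    (hW : Win F G ∅ ∅) : AliceWins F G := by
  classical
  obtain ⟨e0, -⟩ := hW.good
  let σ : Strategy α := fun l =>
    if h : ∃ e, Good F G (bl l) (rd l) e then h.choose
    else if h : ∃ e ∈ G.edgeSet, e ∉ l then h.choose else e0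
  have hσ : ∀ l, (∃ e, Good F G (bl l) (rd l) e) → Good F G (bl l) (rd l) (σ l) := by
    intro l h
    simp only [σ, dif_pos h]
    exact h.choose_spec
  refine ⟨σ, ?_, ?_⟩
  · intro l hl
    by_cases h : ∃ e, Good F G (bl l) (rd l) e
    · have := (hσ l h).1
      exact ⟨this.1, fun h' => ((mem_iff_bl_rd l _).1 h').elim this.2.1 this.2.2⟩
    · simp only [σ, dif_neg h, dif_pos hl]
      exact hl.choose_spec
  intro τ hτ
  by_contra hcon
  push Not at hcon
  have key : ∀ k, Win F G (bl (hist σ τ (2 * k))) (rd (hist σ τ (2 * k))) ∧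
      (hist σ τ (2 * k)).Nodup ∧ ∀ e ∈ hist σ τ (2 * k), e ∈ G.edgeSet := by
    intro k
    induction k with
    | zero =>
      refine ⟨?_, by simp [hist], by simp [hist]⟩
      have h1 : bl (hist σ τ (2 * 0)) = ∅ := by simp [bl, hist]
      have h2 : rd (hist σ τ (2 * 0)) = ∅ := by simp [rd, hist]
      rw [h1, h2]; exact hW
    | succ k ih =>
      obtain ⟨hw, hnd, hed⟩ := ih
      have hg := hσ _ hw.good
      have hmv : σ (hist σ τ (2 * k)) = move σ τ (2 * k) := by simp [move]
      rw [hmv] at hg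
      obtain ⟨hfree, hg⟩ := hg
      have hnot : move σ τ (2 * k) ∉ hist σ τ (2 * k) := fun h' =>
        ((mem_iff_bl_rd _ _).1 h').elim hfree.2.1 hfree.2.2
      have hnd1 : (hist σ τ (2 * k + 1)).Nodup := by
        rw [hist_succ]; exact List.nodup_append.2 ⟨hnd, by simp, by
          intro a ha b hb; simp at hb; subst hb; rintro rfl; exact hnot ha⟩
      have hed1 : ∀ e ∈ hist σ τ (2 * k + 1), e ∈ G.edgeSet := by
        intro e he
        rw [hist_succ] at he
        simp at he
        rcases he with he | rfl
        · exact hed e he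
        · exact hfree.1
      have hlen := nodup_le G _ hnd1 hed1
      rw [hist_length] at hlen
      have hblue : {e | ∃ i ≤ k, e = move σ τ (2 * i)} =
          insert (move σ τ (2 * k)) (bl (hist σ τ (2 * k))) := by
        rw [bl_hist_even, ← set_lt_succ (fun i => move σ τ (2 * i))]
        simp only [Nat.lt_succ_iff]
      rcases hg with ⟨h1, h2⟩ | ⟨⟨f0, hf0⟩, h2⟩
      · exact absurd (hcon k hlen (by rw [hblue]; exact h1)) (by rw [← rd_hist_even]; exact h2)
      · have hmem : ∀ f, f ∈ hist σ τ (2 * k + 1) ↔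
            f ∈ insert (move σ τ (2 * k)) (bl (hist σ τ (2 * k))) ∨ f ∈ rd (hist σ τ (2 * k)) := by
          intro f
          rw [hist_succ, List.mem_append, mem_iff_bl_rd]
          simp only [List.mem_singleton, Set.mem_insert_iff]
          tauto
        have hτm : τ (hist σ τ (2 * k + 1)) = move σ τ (2 * k + 1) := by
          have : (2 * k + 1) % 2 ≠ 0 := by omega
          simp [move, this]
        have hv := hτ (hist σ τ (2 * k + 1)) ⟨f0, hf0.1, fun h => by
          rcases (hmem f0).1 h with h | h
          · exact hf0.2.1 h
          · exact hf0.2.2 h⟩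
        rw [hτm] at hv
        have hff : Free G (insert (move σ τ (2 * k)) (bl (hist σ τ (2 * k))))
            (rd (hist σ τ (2 * k))) (move σ τ (2 * k + 1)) :=
          ⟨hv.1, fun h => hv.2 ((hmem _).2 (Or.inl h)), fun h => hv.2 ((hmem _).2 (Or.inr h))⟩
        have hw2 := h2 _ hff
        refine ⟨?_, ?_, ?_⟩
        · have e1 : bl (hist σ τ (2 * (k + 1))) =
              insert (move σ τ (2 * k)) (bl (hist σ τ (2 * k))) := by
            rw [bl_hist_even, bl_hist_even, ← set_lt_succ (fun i => move σ τ (2 * i))]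
          have e2 : rd (hist σ τ (2 * (k + 1))) =
              insert (move σ τ (2 * k + 1)) (rd (hist σ τ (2 * k))) := by
            rw [rd_hist_even, rd_hist_even, ← set_lt_succ (fun i => move σ τ (2 * i + 1))]
          rw [e1, e2]; exact hw2
        · show (hist σ τ (2 * k + 1 + 1)).Nodup
          rw [hist_succ]; exact List.nodup_append.2 ⟨hnd1, by simp, by
            intro a ha b hb; simp at hb; subst hb; rintro rfl; exact hv.2 ha⟩
        · show ∀ e ∈ hist σ τ (2 * k + 1 + 1), e ∈ G.edgeSet
          intro e he
          rw [hist_succ (n := 2 * k + 1)] at he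
          simp only [List.mem_append, List.mem_singleton] at he
          rcases he with he | rfl
          · exact hed1 e he
          · exact hv.1
  have h := key (G.edgeSet.ncard + 1)
  have := nodup_le G _ h.2.1 h.2.2
  rw [hist_length] at this
  omega

/-! Perfect matchings -/

inductive PM {α : Type*} [DecidableEq α] (S : Set (Sym2 α)) : Finset α → Prop
  | nil : PM S ∅
  | cons (x y : α) (W : Finset α) : x ≠ y → x ∉ W → y ∉ W → s(x, y) ∈ S → PM S W →
      PM S (insert x (insert y W))

theorem PM.mono {α : Type*} [DecidableEq α] {S T : Set (Sym2 α)} (h : S ⊆ T) {W : Finset α}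
    (hp : PM S W) : PM T W := by
  induction hp with
  | nil => exact .nil
  | cons x y W h1 h2 h3 h4 _ ih => exact .cons x y W h1 h2 h3 (h h4) ih

theorem PM.emb {α : Type*} [DecidableEq α] {S : Set (Sym2 α)} {W : Finset α} (hp : PM S W) :
    ∃ k, W.card = 2 * k ∧ ∃ f : Fin k ⊕ Fin k → α, Function.Injective f ∧
      (∀ z, f z ∈ W) ∧ ∀ i, s(f (Sum.inl i), f (Sum.inr i)) ∈ S := by
  induction hp with
  | nil => exact ⟨0, rfl, fun z => (z.elim Fin.elim0 Fin.elim0), fun z => (z.elim Fin.elim0 Fin.elim0),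
      fun z => (z.elim Fin.elim0 Fin.elim0), fun i => i.elim0⟩
  | cons x y W h1 h2 h3 h4 _ ih =>
    obtain ⟨k, hk, f, hf, hW, hS⟩ := ih
    refine ⟨k + 1, ?_, Sum.elim (Fin.cons x (f ∘ Sum.inl)) (Fin.cons y (f ∘ Sum.inr)), ?_, ?_, ?_⟩
    · rw [Finset.card_insert_of_notMem (by simp [h1, h2]), Finset.card_insert_of_notMem h3, hk]
      ring
    · have hx : ∀ z, f z ≠ x := fun z h => h2 (h ▸ hW z)
      have hy : ∀ z, f z ≠ y := fun z h => h3 (h ▸ hW z)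
      rintro (a | a) (b | b) <;> refine Fin.cases ?_ (fun a => ?_) a <;>
        refine Fin.cases ?_ (fun b => ?_) b <;>
        simp [h1, h1.symm, hx, hy, (hx _).symm, (hy _).symm, hf.eq_iff]
    · rintro (a | a) <;> refine Fin.cases ?_ (fun a => ?_) a <;> simp [hW]
    · refine Fin.cases ?_ (fun i => ?_)
      · simpa using h4
      · simpa using hS i

theorem hasCopy_of {α : Type*} {S : Set (Sym2 α)} {m : ℕ} (f : Fin m ⊕ Fin m → α)
    (hf : Function.Injective f) (h : ∀ i, s(f (Sum.inl i), f (Sum.inr i)) ∈ S) :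
    HasCopy (matching m) S := by
  refine ⟨⟨f, hf⟩, ?_⟩
  intro a b hab
  simp only [matching, SimpleGraph.fromRel_adj] at hab
  obtain ⟨-, ⟨i, rfl, rfl⟩ | ⟨i, rfl, rfl⟩⟩ := hab
  · exact h i
  · rw [Sym2.eq_swap]; exact h i

theorem PM.hasCopy {α : Type*} [DecidableEq α] [Fintype α] {S : Set (Sym2 α)} {m : ℕ}
    (hc : Fintype.card α = 2 * m) {W : Finset α} (hW : ∀ v, v ∈ W)
    (hp : PM S W) : HasCopy (matching m) S := by
  obtain ⟨k, hk, f, hf, -, hS⟩ := hp.emb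
  have : W = Finset.univ := by ext; simp [hW]
  rw [this, Finset.card_univ, hc] at hk
  have : m = k := by omega
  subst this
  exact hasCopy_of f hf hS

theorem HasCopy.edge {α : Type*} {S : Set (Sym2 α)} {m : ℕ} (h : HasCopy (matching m) S) :
    ∃ f : Fin m ⊕ Fin m ↪ α, ∀ i, s(f (Sum.inl i), f (Sum.inr i)) ∈ S := by
  obtain ⟨f, hf⟩ := h
  refine ⟨f, fun i => hf _ _ ?_⟩
  simp [matching]

theorem HasCopy.mono {α β : Type*} {F : SimpleGraph β} {S T : Set (Sym2 α)} (h : S ⊆ T)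
    (hp : HasCopy F S) : HasCopy F T := by
  obtain ⟨f, hf⟩ := hp
  exact ⟨f, fun a b hab => h (hf a b hab)⟩

theorem HasCopy.cover {α : Type*} [Fintype α] {S : Set (Sym2 α)} {m : ℕ}
    (hc : Fintype.card α = 2 * m) (h : HasCopy (matching m) S) (v : α) : ∃ e ∈ S, v ∈ e := by
  obtain ⟨f, hf⟩ := h.edge
  have hb : Function.Bijective f := by
    rw [Fintype.bijective_iff_injective_and_card]
    refine ⟨f.injective, ?_⟩
    simp [hc]; ring
  obtain ⟨i | i, rfl⟩ := hb.2 v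
  · exact ⟨_, hf i, by simp⟩
  · exact ⟨_, hf i, by simp⟩

theorem HasCopy.sub {α : Type*} {S : Set (Sym2 α)} {m : ℕ} (h : HasCopy (matching m) S) :
    ∃ P ⊆ S, P.ncard = m ∧ ∀ e ∈ P, ∀ e' ∈ P, ∀ v, v ∈ e → v ∈ e' → e = e' := by
  obtain ⟨f, hf⟩ := h.edge
  have key : ∀ i j v, v ∈ s(f (Sum.inl i), f (Sum.inr i)) → v ∈ s(f (Sum.inl j), f (Sum.inr j)) →
      i = j := by
    intro i j v h1 h2
    rw [Sym2.mem_iff] at h1 h2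
    rcases h1 with rfl | rfl <;> rcases h2 with h2 | h2 <;> simpa using h2
  refine ⟨Set.range fun i => s(f (Sum.inl i), f (Sum.inr i)), ?_, ?_, ?_⟩
  · rintro _ ⟨i, rfl⟩; exact hf i
  · have hinj : Function.Injective fun i => s(f (Sum.inl i), f (Sum.inr i)) := by
      intro i j hij
      refine key i j (f (Sum.inl i)) (by simp) ?_
      simp only at hij
      rw [← hij]; simp
    rw [← Set.image_univ, Set.ncard_image_of_injective _ hinj, Set.ncard_univ]
    simp
  · rintro _ ⟨i, rfl⟩ _ ⟨j, rfl⟩ v h1 h2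
    simp only at h1 h2 ⊢
    rw [key i j v h1 h2]

theorem no_copy {α : Type*} [Finite α] {R : Set (Sym2 α)} {m : ℕ} (hR : R.ncard ≤ m + 1)
    (h : ∀ P ⊆ R, (∀ e ∈ P, ∀ e' ∈ P, ∀ v, v ∈ e → v ∈ e' → e = e') →
      ∃ e1 ∈ R, ∃ e2 ∈ R, e1 ≠ e2 ∧ e1 ∉ P ∧ e2 ∉ P) : ¬ HasCopy (matching m) R := by
  intro hc
  obtain ⟨P, hP, hm, hd⟩ := hc.sub
  obtain ⟨e1, h1, e2, h2, hne, n1, n2⟩ := h P hP hd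
  have hsub : insert e1 (insert e2 P) ⊆ R := by
    intro x hx
    rcases hx with rfl | rfl | hx
    · exact h1
    · exact h2
    · exact hP hx
  have := Set.ncard_le_ncard hsub (Set.toFinite _)
  rw [Set.ncard_insert_of_notMem (by simp [hne, n1]) (Set.toFinite _),
    Set.ncard_insert_of_notMem n2 (Set.toFinite _)] at this
  omega

/-! The endgame on six vertices -/

structure Six {α : Type*} (W : Finset α) (u v a b c d : α) : Prop where
  nd : [u, v, a, b, c, d].Nodup
  out : ∀ x ∈ [u, v, a, b, c, d], x ∉ W
  cov : ∀ x, x ∈ W ∨ x ∈ [u, v, a, b, c, d]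

theorem Six.perm {α : Type*} {W : Finset α} {u v a b c d u' v' a' b' c' d' : α}
    (h : Six W u v a b c d) (hp : [u, v, a, b, c, d].Perm [u', v', a', b', c', d']) :
    Six W u' v' a' b' c' d' :=
  ⟨hp.nodup_iff.1 h.nd, fun x hx => h.out x (hp.mem_iff.2 hx), fun x => by
    rw [← hp.mem_iff]; exact h.cov x⟩

theorem Six.copy {α : Type*} [DecidableEq α] [Fintype α] {m : ℕ} (hc : Fintype.card α = 2 * m)
    {W : Finset α} {u v a b c d : α} (h : Six W u v a b c d) {S : Set (Sym2 α)} (hp : PM S W)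
    (h1 : s(u, v) ∈ S) (h2 : s(a, b) ∈ S) (h3 : s(c, d) ∈ S) : HasCopy (matching m) S := by
  obtain ⟨nd, out, cov⟩ := h
  simp only [List.nodup_cons, List.mem_cons, List.not_mem_nil, or_false, not_or,
    forall_eq_or_imp, forall_eq] at nd out cov
  have p1 : PM S (insert c (insert d W)) :=
    .cons c d W (by tauto) (by tauto) (by tauto) h3 hp
  have p2 : PM S (insert a (insert b (insert c (insert d W)))) :=
    .cons a b _ (by tauto) (by simp; tauto) (by simp; tauto) h2 p1
  have p3 : PM S (insert u (insert v (insert a (insert b (insert c (insert d W)))))) :=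
    .cons u v _ (by tauto) (by simp; tauto) (by simp; tauto) h1 p2
  refine p3.hasCopy hc (fun x => ?_)
  have := cov x
  simp
  tauto

theorem endgame {α : Type*} [DecidableEq α] [Fintype α] {m : ℕ} (hc : Fintype.card α = 2 * m)
    {W : Finset α} {u v a b c d : α} (h : Six W u v a b c d) {B R : Set (Sym2 α)} (hp : PM B W)
    (hab : s(a, b) ∈ B) (hcd : s(c, d) ∈ B)
    (b1 : s(u, a) ∉ B) (b2 : s(v, b) ∉ B) (b3 : s(v, c) ∉ B) (b4 : s(b, d) ∉ B) (b5 : s(d, u) ∉ B)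
    (r1 : s(u, a) ∉ R) (r2 : s(v, b) ∉ R) (r3 : s(v, c) ∉ R) (r4 : s(b, d) ∉ R) (r5 : s(d, u) ∉ R)
    (hN : ∀ f, f ∉ B → ¬ HasCopy (matching m) (insert f (insert s(v, b) R))) :
    Win (matching m) (⊤ : SimpleGraph α) B R := by
  have nd := h.nd
  simp only [List.nodup_cons, List.mem_cons, List.not_mem_nil, or_false, not_or] at nd
  obtain ⟨⟨n1, n2, n3, n4, n5⟩, ⟨n6, n7, n8, n9⟩, ⟨n10, n11, n12⟩, ⟨n13, n14⟩, n15, -⟩ := nd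
  refine Win.later _ _ s(u, a) ⟨by simpa using n2, b1, r1⟩
    ⟨s(v, b), by simpa using n7, by simp [b2]; grind, r2⟩ ?_
  intro f hf
  by_cases hfe : f = s(v, b)
  · subst hfe
    refine Win.later _ _ s(v, c) ⟨by simpa using n8, by simp [b3]; grind, by simp [r3]; grind⟩
      ⟨s(b, d), by simpa using n14, by simp [b4]; grind, by simp [r4]; grind⟩ ?_
    intro f hf'
    have hfB : f ∉ B := fun h => hf'.2.1 (by simp [h])
    by_cases hfe : f = s(b, d)
    · subst hfe
      refine Win.now _ _ s(d, u) ⟨by simpa using fun h => n5 h.symm, by simp [b5]; grind, by simp [r5]; grind⟩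
        ?_ (hN _ hfB)
      exact Six.copy hc (u := a) (v := b) (a := v) (b := c) (c := d) (d := u)
        (h.perm (by grind)) (hp.mono (by intro; simp; tauto)) (by simp [hab])
        (by simp) (by simp)
    · refine Win.now _ _ s(b, d) ⟨by simpa using n14, by simp [b4]; grind, by simp [r4]; grind⟩
        ?_ (hN _ hfB)
      exact Six.copy hc (u := u) (v := a) (a := v) (b := c) (c := b) (d := d)
        (h.perm (by grind)) (hp.mono (by intro; simp; tauto)) (by simp)
        (by simp) (by simp)
  · refine Win.now _ _ s(v, b) ⟨by simpa using n7, by simp [b2]; grind, by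
      simp [r2]; exact fun h => hfe h.symm⟩ ?_ ?_
    · exact Six.copy hc (u := u) (v := a) (a := v) (b := b) (c := c) (d := d)
        (h.perm (by grind)) (hp.mono (by intro; simp; tauto)) (by simp) (by simp) (by simp [hcd])
    · intro h
      exact hN f (fun h => hf.2.1 (by simp [h])) (h.mono (by intro; simp; tauto))

/-- Two free vertices pairs `x1,x3`, `x2,x4`, blue `pq`; case A. -/
theorem phaseA {α : Type*} [DecidableEq α] [Fintype α] {m : ℕ} (hc : Fintype.card α = 2 * m)
    {W : Finset α} {p q x1 x2 x3 x4 : α} (h : Six W p q x1 x2 x3 x4) {B R : Set (Sym2 α)}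
    (hp : PM B W) (hB : ∀ e ∈ B, ∀ v ∈ [p, q, x1, x2, x3, x4], v ∉ e)
    (r1 : s(x1, x3) ∉ R) (r2 : s(x2, x4) ∉ R) (r3 : s(x4, x1) ∉ R) (r4 : s(x2, x3) ∉ R)
    (r5 : s(x2, p) ∉ R) (r6 : s(x3, q) ∉ R) (r7 : s(x4, q) ∉ R)
    (hN : ∀ f, ¬ HasCopy (matching m) (insert f (insert s(x2, x3) (insert s(x2, x4) R)))) :
    Win (matching m) (⊤ : SimpleGraph α) (insert s(p, q) B) R := by
  have nd := h.nd
  simp only [List.nodup_cons, List.mem_cons, List.not_mem_nil, or_false, not_or] at nd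
  obtain ⟨⟨n1, n2, n3, n4, n5⟩, ⟨n6, n7, n8, n9⟩, ⟨n10, n11, n12⟩, ⟨n13, n14⟩, n15, -⟩ := nd
  have hBn : ∀ v ∈ [p, q, x1, x2, x3, x4], ∀ w, s(v, w) ∉ B := fun v hv w hB' =>
    hB _ hB' v hv (by simp)
  simp only [List.mem_cons, List.not_mem_nil, or_false, forall_eq_or_imp, forall_eq] at hBn
  obtain ⟨c1, c2, c3, c4, c5, c6⟩ := hBn
  refine Win.later _ _ s(x1, x3) ⟨by simpa using n11, by simp [c3]; grind, r1⟩
    ⟨s(x2, x4), by simpa using n14, by simp [c4]; grind, r2⟩ ?_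
  intro f hf
  by_cases hfe : f = s(x2, x4)
  · subst hfe
    exact endgame hc (u := x4) (v := x2) (a := x1) (b := x3) (c := p) (d := q)
      (h.perm (by grind)) (hp.mono (by intro; simp; tauto)) (by simp) (by simp)
      (by simp [c6]; grind) (by simp [c4]; grind) (by simp [c4]; grind)
      (by simp [c5]; grind) (by simp [c2]; grind)
      (by simp [r3]; grind) (by simp [r4]; grind) (by simp [r5]; grind)
      (by simp [r6]; grind) (by rw [Sym2.eq_swap]; simp [r7]; grind)
      (fun f _ => hN f)
  · refine Win.now _ _ s(x2, x4) ⟨by simpa using n14, by simp [c4]; grind, by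
      simp [r2]; exact fun h => hfe h.symm⟩ ?_ ?_
    · exact Six.copy hc (u := p) (v := q) (a := x1) (b := x3) (c := x2) (d := x4)
        (h.perm (by grind)) (hp.mono (by intro; simp; tauto)) (by simp) (by simp) (by simp)
    · intro h
      exact hN f (h.mono (by intro; simp; tauto))

theorem phaseB {α : Type*} [DecidableEq α] [Fintype α] {m : ℕ} (hc : Fintype.card α = 2 * m)
    {W : Finset α} {p q x1 x2 x3 x4 : α} (h : Six W p q x1 x2 x3 x4) {B R : Set (Sym2 α)}
    (hp : PM B W) (hB : ∀ e ∈ B, ∀ v ∈ [p, q, x1, x2, x3, x4], v ∉ e)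
    (hR : ∀ e ∈ R, ∀ v ∈ [x1, x2, x3, x4], v ∉ e) :
    Win (matching m) (⊤ : SimpleGraph α) (insert s(p, q) B) R := by
  have nd := h.nd
  simp only [List.nodup_cons, List.mem_cons, List.not_mem_nil, or_false, not_or] at nd
  obtain ⟨⟨n1, n2, n3, n4, n5⟩, ⟨n6, n7, n8, n9⟩, ⟨n10, n11, n12⟩, ⟨n13, n14⟩, n15, -⟩ := nd
  have hBn : ∀ v ∈ [p, q, x1, x2, x3, x4], ∀ w, s(v, w) ∉ B := fun v hv w hB' =>
    hB _ hB' v hv (by simp)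
  have hRn : ∀ v ∈ [x1, x2, x3, x4], ∀ w, s(v, w) ∉ R := fun v hv w hB' =>
    hR _ hB' v hv (by simp)
  simp only [List.mem_cons, List.not_mem_nil, or_false, forall_eq_or_imp, forall_eq] at hBn hRn
  obtain ⟨c1, c2, c3, c4, c5, c6⟩ := hBn
  obtain ⟨r1, r2, r3, r4⟩ := hRn
  have hN : ∀ f, f ≠ s(x1, x3) →
      ¬ HasCopy (matching m) (insert f (insert s(x2, q) (insert s(x2, x4) R))) := by
    intro f hf hcp
    obtain ⟨e1, he1, hv1⟩ := hcp.cover hc x1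
    obtain ⟨e3, he3, hv3⟩ := hcp.cover hc x3
    have k1 : e1 = f := by
      rcases he1 with he | he | he | he
      · exact he
      · subst he; simp at hv1; grind
      · subst he; simp at hv1; grind
      · exact absurd hv1 (hR _ he x1 (by simp))
    have k3 : e3 = f := by
      rcases he3 with he | he | he | he
      · exact he
      · subst he; simp at hv3; grind
      · subst he; simp at hv3; grind
      · exact absurd hv3 (hR _ he x3 (by simp))
    subst k1; subst k3
    exact hf ((Sym2.mem_and_mem_iff n11).1 ⟨hv1, hv3⟩)
  refine Win.later _ _ s(x1, x3) ⟨by simpa using n11, by simp [c3]; grind, r1 _⟩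
    ⟨s(x2, x4), by simpa using n14, by simp [c4]; grind, r2 _⟩ ?_
  intro f hf
  by_cases hfe : f = s(x2, x4)
  · subst hfe
    exact endgame hc (u := x4) (v := x2) (a := p) (b := q) (c := x1) (d := x3)
      (h.perm (by grind)) (hp.mono (by intro; simp; tauto)) (by simp) (by simp)
      (by simp [c6]; grind) (by simp [c4]; grind) (by simp [c4]; grind)
      (by simp [c2]; grind) (by simp [c5]; grind)
      (by simp [r4]; grind) (by simp [r2]; grind) (by simp [r2]; grind)
      (by rw [Sym2.eq_swap]; simp [r3]; grind) (by simp [r3]; grind)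
      (fun f hf => hN f (fun h => hf (by simp [h])))
  · refine Win.now _ _ s(x2, x4) ⟨by simpa using n14, by simp [c4]; grind, by
      simp [r2]; exact fun h => hfe h.symm⟩ ?_ ?_
    · exact Six.copy hc (u := p) (v := q) (a := x1) (b := x3) (c := x2) (d := x4)
        (h.perm (by grind)) (hp.mono (by intro; simp; tauto)) (by simp) (by simp) (by simp)
    · intro h
      exact hN f (fun h => hf.2.1 (by simp [h])) (h.mono (by intro; simp; tauto))

theorem ncard_ins3 {α : Type*} (R : Set (Sym2 α)) (a b c : Sym2 α) {m : ℕ} (h : R.ncard + 2 ≤ m) :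
    (insert a (insert b (insert c R))).ncard ≤ m + 1 := by
  have h1 := Set.ncard_insert_le a (insert b (insert c R))
  have h2 := Set.ncard_insert_le b (insert c R)
  have h3 := Set.ncard_insert_le c R
  omega

theorem nc_star {α : Type*} [Finite α] {m : ℕ} {R : Set (Sym2 α)} (hR : R.ncard + 2 ≤ m)
    {x2 x3 x4 : α} (h34 : x3 ≠ x4) (r1 : s(x2, x3) ∉ R) (r2 : s(x2, x4) ∉ R)
    (g : Sym2 α) (hg : g ∈ R) (hx : x2 ∈ g) (f : Sym2 α) :
    ¬ HasCopy (matching m) (insert f (insert s(x2, x3) (insert s(x2, x4) R))) := by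
  refine no_copy (ncard_ins3 _ _ _ _ hR) ?_
  intro P _ hP
  have h1 : g ≠ s(x2, x3) := fun h => r1 (h ▸ hg)
  have h2 : g ≠ s(x2, x4) := fun h => r2 (h ▸ hg)
  have h3 : s(x2, x3) ≠ s(x2, x4) := fun h => h34 (Sym2.congr_right.1 h)
  have k1 := fun a b => hP g a s(x2, x3) b x2 hx (by simp)
  have k2 := fun a b => hP g a s(x2, x4) b x2 hx (by simp)
  have k3 := fun a b => hP s(x2, x3) a s(x2, x4) b x2 (by simp) (by simp)
  by_cases q1 : g ∈ P
  · exact ⟨s(x2, x3), by simp, s(x2, x4), by simp, h3, fun h => h1 (k1 q1 h), fun h => h2 (k2 q1 h)⟩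
  · by_cases q2 : s(x2, x3) ∈ P
    · exact ⟨g, by simp [hg], s(x2, x4), by simp, h2, q1, fun h => h3 (k3 q2 h)⟩
    · exact ⟨g, by simp [hg], s(x2, x3), by simp, h1, q1, q2⟩

theorem nc_two {α : Type*} [Finite α] {m : ℕ} {R : Set (Sym2 α)} (hR : R.ncard + 2 ≤ m)
    {x2 x3 x4 y p q : α} (h34 : x3 ≠ x4) (hpq : p ≠ q) (r1 : s(x2, x3) ∉ R) (r2 : s(x2, x4) ∉ R)
    (g1 : s(y, p) ∈ R) (g2 : s(y, q) ∈ R) (f : Sym2 α) :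
    ¬ HasCopy (matching m) (insert f (insert s(x2, x3) (insert s(x2, x4) R))) := by
  refine no_copy (ncard_ins3 _ _ _ _ hR) ?_
  intro P _ hP
  have key : ∀ (z a b : α), a ≠ b → ∃ c, (c = a ∨ c = b) ∧ s(z, c) ∉ P := by
    intro z a b hab
    by_contra hcon
    push Not at hcon
    have := hP _ (hcon a (Or.inl rfl)) _ (hcon b (Or.inr rfl)) z (by simp) (by simp)
    exact hab (Sym2.congr_right.1 this)
  obtain ⟨c, hc, hc'⟩ := key x2 x3 x4 h34
  obtain ⟨d, hd, hd'⟩ := key y p q hpq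
  have hcR : s(x2, c) ∉ R := by rcases hc with rfl | rfl <;> assumption
  have hdR : s(y, d) ∈ R := by rcases hd with rfl | rfl <;> assumption
  refine ⟨s(x2, c), ?_, s(y, d), by simp [hdR], fun h => hcR (h ▸ hdR), hc', hd'⟩
  rcases hc with rfl | rfl <;> simp

theorem four {α : Type*} [DecidableEq α] {U : Finset α} (hU : U.card = 4) {a b : α} (ha : a ∈ U)
    (hb : b ∈ U) (hab : a ≠ b) : ∃ c d, U = {a, b, c, d} ∧ c ≠ d ∧ c ≠ a ∧ c ≠ b ∧ d ≠ a ∧ d ≠ b := by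
  have h1 : ((U.erase a).erase b).card = 2 := by
    rw [Finset.card_erase_of_mem (by simp [hb, hab.symm]), Finset.card_erase_of_mem ha, hU]
  obtain ⟨c, d, hcd, he⟩ := Finset.card_eq_two.1 h1
  have hc : c ∈ (U.erase a).erase b := by simp [he]
  have hd : d ∈ (U.erase a).erase b := by simp [he]
  simp only [Finset.mem_erase] at hc hd
  refine ⟨c, d, ?_, hcd, hc.2.1, hc.1, hd.2.1, hd.1⟩
  rw [← he, Finset.insert_erase (by simp [hb, hab.symm]), Finset.insert_erase ha]

theorem phaseA2 {α : Type*} [DecidableEq α] [Fintype α] {m : ℕ} (hc : Fintype.card α = 2 * m)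
    {W : Finset α} {p q x1 x2 x3 x4 : α} (h : Six W p q x1 x2 x3 x4) {B R : Set (Sym2 α)}
    (hp : PM B W) (hB : ∀ e ∈ B, ∀ v ∈ [p, q, x1, x2, x3, x4], v ∉ e)
    (r1 : s(x1, x3) ∉ R) (r2 : s(x2, x4) ∉ R) (r3 : s(x4, x1) ∉ R) (r4 : s(x2, x3) ∉ R)
    (r : (s(x2, p) ∉ R ∧ s(x3, q) ∉ R ∧ s(x4, q) ∉ R) ∨
      (s(x2, q) ∉ R ∧ s(x3, p) ∉ R ∧ s(x4, p) ∉ R))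
    (hN : ∀ f, ¬ HasCopy (matching m) (insert f (insert s(x2, x3) (insert s(x2, x4) R)))) :
    Win (matching m) (⊤ : SimpleGraph α) (insert s(p, q) B) R := by
  rcases r with ⟨r5, r6, r7⟩ | ⟨r5, r6, r7⟩
  · exact phaseA hc h hp hB r1 r2 r3 r4 r5 r6 r7 hN
  · rw [Sym2.eq_swap]
    exact phaseA hc (h.perm (by grind)) hp (by
      intro e he v hv; exact hB e he v (by simp only [List.mem_cons] at hv ⊢; tauto))
      r1 r2 r3 r4 r5 r6 r7 hN

theorem label {α : Type*} [DecidableEq α] [Fintype α] {m : ℕ} (hc : Fintype.card α = 2 * m)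
    {W U : Finset α} {p q : α} (hU : U.card = 4)
    (hsix : ∀ x1 x2 x3 x4, U = {x1, x2, x3, x4} → Six W p q x1 x2 x3 x4)
    {B R : Set (Sym2 α)} (hp : PM B W) (hB : ∀ e ∈ B, ∀ v ∉ W, v ∉ e)
    (hA : ∀ a ∈ U, ∀ b ∈ U, s(a, b) ∉ R) (hQ : ∀ a ∈ U, s(a, q) ∉ R)
    (hP : ∀ a ∈ U, ∀ b ∈ U, s(a, p) ∈ R → s(b, p) ∈ R → a = b)
    (hm : R.ncard + 3 ≤ m) (f : Sym2 α) (hf : ¬ f.IsDiag) :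
    Win (matching m) (⊤ : SimpleGraph α) (insert s(p, q) B) (insert f R) := by
  have hm' : (insert f R).ncard + 2 ≤ m := by
    have := Set.ncard_insert_le f R
    omega
  have hB' : ∀ {x1 x2 x3 x4}, Six W p q x1 x2 x3 x4 →
      ∀ e ∈ B, ∀ v ∈ [p, q, x1, x2, x3, x4], v ∉ e := by
    intro x1 x2 x3 x4 h e he v hv
    exact hB e he v (h.out v hv)
  by_cases hfU : ∃ a ∈ U, ∃ b ∈ U, f = s(a, b)
  · obtain ⟨x2, h2, x1, h1, rfl⟩ := hfU
    have h12 : x1 ≠ x2 := by rintro rfl; simp at hf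
    obtain ⟨x3, x4, hUe, h34, h31, h32, h41, h42⟩ := four hU h1 h2 h12
    have h3 : x3 ∈ U := by simp [hUe]
    have h4 : x4 ∈ U := by simp [hUe]
    have S := hsix _ _ _ _ hUe
    have nd := S.nd
    simp only [List.nodup_cons, List.mem_cons, List.not_mem_nil, or_false, not_or] at nd
    have r4 : s(x2, x3) ∉ insert s(x2, x1) R := by simp [hA _ h2 _ h3]; grind
    have r2 : s(x2, x4) ∉ insert s(x2, x1) R := by simp [hA _ h2 _ h4]; grind
    refine phaseA2 hc S hp (hB' S) ?_ r2 ?_ r4 ?_ (nc_star hm' h34 r4 r2 s(x2, x1) (by simp)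
      (by simp))
    · simp [hA _ h1 _ h3]; grind
    · simp [hA _ h4 _ h1]; grind
    · by_cases hx : s(x2, p) ∈ R
      · right
        refine ⟨?_, ?_, ?_⟩
        · simp [hQ _ h2]; grind
        · have := fun h => hP _ h2 _ h3 hx h
          simp; grind
        · have := fun h => hP _ h2 _ h4 hx h
          simp; grind
      · left
        refine ⟨?_, ?_, ?_⟩
        · simp [hx]; grind
        · simp [hQ _ h3]; grind
        · simp [hQ _ h4]; grind
  push Not at hfU
  have hA' : ∀ a ∈ U, ∀ b ∈ U, s(a, b) ∉ insert f R := by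
    intro a ha b hb h
    rcases h with h | h
    · exact hfU a ha b hb h.symm
    · exact hA a ha b hb h
  by_cases hiso : ∀ e ∈ insert f R, ∀ v ∈ U, v ∉ e
  · obtain ⟨a, ha, b, hb, hab⟩ := Finset.one_lt_card.1 (show 1 < U.card by omega)
    obtain ⟨c, d, hUe, -⟩ := four hU ha hb hab
    have S := hsix _ _ _ _ hUe
    refine phaseB hc S hp (hB' S) ?_
    intro e he v hv
    exact hiso e he v (by rw [hUe]; simpa using hv)
  push Not at hiso
  have hx2 : ∃ x2 ∈ U, (∃ g ∈ insert f R, x2 ∈ g) ∧ ∀ a ∈ U, s(a, p) ∈ R → a = x2 := by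
    by_cases h : ∃ a ∈ U, s(a, p) ∈ R
    · obtain ⟨a, ha, h⟩ := h
      exact ⟨a, ha, ⟨_, Or.inr h, by simp⟩, fun b hb h' => hP b hb a ha h' h⟩
    · obtain ⟨g, hg, v, hv, hvg⟩ := hiso
      exact ⟨v, hv, ⟨g, hg, hvg⟩, fun a ha h' => absurd ⟨a, ha, h'⟩ h⟩
  obtain ⟨x2, h2, ⟨g, hg, hxg⟩, hx2p⟩ := hx2
  have hpU : p ∉ U ∧ q ∉ U ∧ p ≠ q := by
    obtain ⟨a, ha, b, hb, hab⟩ := Finset.one_lt_card.1 (show 1 < U.card by omega)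
    obtain ⟨c, d, hUe, -⟩ := four hU ha hb hab
    have nd := (hsix _ _ _ _ hUe).nd
    simp only [List.nodup_cons, List.mem_cons, List.not_mem_nil, or_false, not_or] at nd
    rw [hUe]
    simp only [Finset.mem_insert, Finset.mem_singleton]
    tauto
  obtain ⟨hpU, hqU, hpq⟩ := hpU
  have hx1 : ∃ x1 ∈ U, x1 ≠ x2 ∧ ∀ a ∈ U, (f = s(a, p) ∨ f = s(a, q)) → a = x2 ∨ a = x1 := by
    by_cases h : ∃ a ∈ U, a ≠ x2 ∧ (f = s(a, p) ∨ f = s(a, q))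
    · obtain ⟨a, ha, hne, h⟩ := h
      refine ⟨a, ha, hne, ?_⟩
      intro b hb h'
      right
      have h5 : b ∈ f := by rcases h' with rfl | rfl <;> simp
      rcases h with rfl | rfl <;> simp at h5 <;> grind
    · obtain ⟨a, ha, hne⟩ := Finset.exists_mem_ne (show 1 < U.card by omega) x2
      exact ⟨a, ha, hne, fun b hb h' => Or.inl (by grind)⟩
  obtain ⟨x1, h1, h12, hx1⟩ := hx1
  obtain ⟨x3, x4, hUe, h34, h31, h32, h41, h42⟩ := four hU h1 h2 h12
  have h3 : x3 ∈ U := by simp [hUe]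
  have h4 : x4 ∈ U := by simp [hUe]
  have S := hsix _ _ _ _ hUe
  have hcross : ∀ a ∈ U, a ≠ x1 → a ≠ x2 → s(a, p) ∉ insert f R ∧ s(a, q) ∉ insert f R := by
    intro a ha n1 n2
    constructor
    · rintro (h | h)
      · have := hx1 a ha (Or.inl h.symm); tauto
      · exact n2 (hx2p a ha h)
    · rintro (h | h)
      · have := hx1 a ha (Or.inr h.symm); tauto
      · exact hQ a ha h
  have c3 := hcross x3 h3 h31 h32
  have c4 := hcross x4 h4 h41 h42
  by_cases hboth : s(x2, p) ∈ insert f R ∧ s(x2, q) ∈ insert f R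
  · have hfe : f = s(x2, q) := by
      rcases hboth.2 with h | h
      · exact h.symm
      · exact absurd h (hQ _ h2)
    have S' : Six W p q x2 x1 x3 x4 := S.perm (.cons _ (.cons _ (.swap _ _ _)))
    refine phaseA2 hc S' hp (hB' S') (hA' _ h2 _ h3) (hA' _ h1 _ h4) (hA' _ h4 _ h2)
      (hA' _ h1 _ h3) (Or.inl ⟨?_, c3.2, c4.2⟩)
      (nc_two hm' h34 hpq (hA' _ h1 _ h3) (hA' _ h1 _ h4) hboth.1 hboth.2)
    rintro (h | h)
    · rw [hfe] at h
      simp at h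
      grind
    · exact h12 (hx2p _ h1 h)
  · refine phaseA2 hc S hp (hB' S) (hA' _ h1 _ h3) (hA' _ h2 _ h4) (hA' _ h4 _ h1)
      (hA' _ h2 _ h3) ?_ (nc_star hm' h34 (hA' _ h2 _ h3) (hA' _ h2 _ h4) g hg hxg)
    by_cases h : s(x2, p) ∈ insert f R
    · exact Or.inr ⟨fun h' => hboth ⟨h, h'⟩, c3.1, c4.1⟩
    · exact Or.inl ⟨h, c3.2, c4.2⟩

/-! The opening phase -/

theorem pick {α : Type*} [DecidableEq α] {U : Finset α} (hU : 6 ≤ U.card) (R : Set (Sym2 α))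
    (hR : ∀ a ∈ U, ∀ b ∈ U, ∀ c ∈ U, ∀ d ∈ U, s(a, b) ∈ R → s(c, d) ∈ R → s(a, b) = s(c, d)) :
    ∃ x ∈ U, ∃ y ∈ U, x ≠ y ∧ s(x, y) ∉ R ∧
      ∀ a ∈ U, ∀ b ∈ U, s(a, b) ∈ R → a = x ∨ b = x := by
  by_cases h : ∃ a ∈ U, ∃ b ∈ U, s(a, b) ∈ R
  · obtain ⟨x, hx, z, hz, hxz⟩ := h
    have h1 : 0 < ((U.erase x).erase z).card := by
      have h1 := Finset.pred_card_le_card_erase (s := U) (a := x)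
      have h2 := Finset.pred_card_le_card_erase (s := U.erase x) (a := z)
      omega
    obtain ⟨y, hy⟩ := Finset.card_pos.1 h1
    simp only [Finset.mem_erase] at hy
    refine ⟨x, hx, y, hy.2.2, fun h => hy.2.1 h.symm, ?_, ?_⟩
    · intro h
      have := hR _ hx _ hz _ hx _ hy.2.2 hxz h
      exact hy.1 (Sym2.congr_right.1 this).symm
    · intro a ha b hb hab
      have := hR _ hx _ hz _ ha _ hb hxz hab
      have h2 : x ∈ s(a, b) := by rw [← this]; simp
      simp at h2
      grind
  · obtain ⟨a, ha, b, hb, hab⟩ := Finset.one_lt_card.1 (show 1 < U.card by omega)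
    exact ⟨a, ha, b, hb, hab, fun h' => h ⟨a, ha, b, hb, h'⟩, fun c hc d hd h' =>
      absurd ⟨c, hc, d, hd, h'⟩ h⟩

theorem opening {α : Type*} [DecidableEq α] [Fintype α] {m : ℕ} (hc : Fintype.card α = 2 * m)
    (j : ℕ) : ∀ (U : Finset α) (B R : Set (Sym2 α)), U.card = 6 + 2 * j → PM B Uᶜ →
    (∀ e ∈ B, ∀ v ∈ U, v ∉ e) →
    (∀ a ∈ U, ∀ b ∈ U, ∀ c ∈ U, ∀ d ∈ U, s(a, b) ∈ R → s(c, d) ∈ R → s(a, b) = s(c, d)) →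
    R.ncard + (3 + j) ≤ m → Win (matching m) (⊤ : SimpleGraph α) B R := by
  induction j with
  | zero =>
    intro U B R hU hp hB hR hm
    obtain ⟨p, hpU, q, hqU, hpq, hpqR, hpR⟩ := pick (by omega) R hR
    have hcard : ((U.erase p).erase q).card = 4 := by
      rw [Finset.card_erase_of_mem (by simp [hqU, hpq.symm]), Finset.card_erase_of_mem hpU, hU]
    obtain ⟨a, ha, b, hb, hab⟩ := Finset.one_lt_card.1
      (show 1 < ((U.erase p).erase q).card by omega)
    have hmemU : ∀ x, x ∈ (U.erase p).erase q ↔ x ≠ q ∧ x ≠ p ∧ x ∈ U := by simp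
    have hA : ∀ a ∈ (U.erase p).erase q, ∀ b ∈ (U.erase p).erase q, s(a, b) ∉ R := by
      intro a ha b hb h
      rw [hmemU] at ha hb
      rcases hpR a ha.2.2 b hb.2.2 h with h | h
      · exact ha.2.1 h
      · exact hb.2.1 h
    refine Win.later _ _ s(p, q) ⟨by simpa using hpq, fun h => hB _ h p hpU (by simp), hpqR⟩
      ⟨s(a, b), by simpa using hab, ?_, hA a ha b hb⟩ ?_
    · rw [hmemU] at ha hb
      rintro (h | h)
      · simp at h; grind
      · exact hB _ h a ha.2.2 (by simp)
    · intro f hf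
      refine label hc (W := Uᶜ) hcard ?_ hp ?_ hA ?_ ?_ (by omega) f ?_
      · intro x1 x2 x3 x4 he
        have hUU : U = {p, q, x1, x2, x3, x4} := by
          rw [← he, Finset.insert_erase (by simp [hqU, hpq.symm]), Finset.insert_erase hpU]
        have hmem : ∀ x, x ∈ [p, q, x1, x2, x3, x4] ↔ x ∈ U := by
          intro x; rw [hUU]; simp
        refine ⟨?_, ?_, ?_⟩
        · have : [p, q, x1, x2, x3, x4].toFinset = U := by ext; simp [hUU]
          rw [← Multiset.coe_nodup, ← Multiset.toFinset_card_eq_card_iff_nodup]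
          simp only [List.toFinset_coe, this, Multiset.coe_card]
          simpa using hU
        · intro x hx; simp [(hmem x).1 hx]
        · intro x; rw [hmem]; simp; tauto
      · intro e he v hv; exact hB e he v (by simpa using hv)
      · intro a ha h
        rw [hmemU] at ha
        rcases hpR a ha.2.2 q hqU h with h | h
        · exact ha.2.1 h
        · exact hpq h.symm
      · intro a ha b hb h1 h2
        rw [hmemU] at ha hb
        have := hR _ ha.2.2 _ hpU _ hb.2.2 _ hpU h1 h2
        simp at this
        grind
      · have := hf.1
        simpa using this
  | succ j ih =>
    intro U B R hU hp hB hR hm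
    obtain ⟨p, hpU, q, hqU, hpq, hpqR, hpR⟩ := pick (by omega) R hR
    have hcard : ((U.erase p).erase q).card = 6 + 2 * j := by
      rw [Finset.card_erase_of_mem (by simp [hqU, hpq.symm]), Finset.card_erase_of_mem hpU, hU]
      omega
    obtain ⟨a, ha, b, hb, hab⟩ := Finset.one_lt_card.1
      (show 1 < ((U.erase p).erase q).card by omega)
    have hmemU : ∀ x, x ∈ (U.erase p).erase q ↔ x ≠ q ∧ x ≠ p ∧ x ∈ U := by simp
    have hA : ∀ a ∈ (U.erase p).erase q, ∀ b ∈ (U.erase p).erase q, s(a, b) ∉ R := by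
      intro a ha b hb h
      rw [hmemU] at ha hb
      rcases hpR a ha.2.2 b hb.2.2 h with h | h
      · exact ha.2.1 h
      · exact hb.2.1 h
    refine Win.later _ _ s(p, q) ⟨by simpa using hpq, fun h => hB _ h p hpU (by simp), hpqR⟩
      ⟨s(a, b), by simpa using hab, ?_, hA a ha b hb⟩ ?_
    · rw [hmemU] at ha hb
      rintro (h | h)
      · simp at h; grind
      · exact hB _ h a ha.2.2 (by simp)
    · intro f hf
      refine ih ((U.erase p).erase q) _ _ hcard ?_ ?_ ?_ ?_
      · have : ((U.erase p).erase q)ᶜ = insert p (insert q Uᶜ) := by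
          ext x; simp only [Finset.mem_compl, hmemU, Finset.mem_insert]; tauto
        rw [this]
        exact .cons p q _ hpq (by simpa using hpU) (by simpa using hqU) (by simp)
          (hp.mono (by intro; simp; tauto))
      · intro e he v hv
        rw [hmemU] at hv
        rcases he with rfl | he
        · simp; tauto
        · exact hB e he v hv.2.2
      · intro a ha b hb c hc d hd h1 h2
        rcases h1 with h1 | h1
        · rcases h2 with h2 | h2
          · rw [h1, h2]
          · exact absurd h2 (hA c hc d hd)
        · exact absurd h1 (hA a ha b hb)
      · have := Set.ncard_insert_le f R
        omega

theorem wins_ge3 (m : ℕ) (hm : 3 ≤ m) :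
    AliceWins (matching m) (⊤ : SimpleGraph (Fin (2 * m))) := by
  apply Win.aliceWins
  refine opening (m := m) (by simp) (m - 3) Finset.univ ∅ ∅ (by simp; omega) ?_ (by simp) (by simp)
    (by simp; omega)
  simpa using PM.nil

theorem wins_1 : AliceWins (matching 1) (⊤ : SimpleGraph (Fin (2 * 1))) := by
  apply Win.aliceWins
  refine Win.now _ _ s(0, 1) ⟨by simp, by simp, by simp⟩ ?_ ?_
  · refine PM.hasCopy (W := insert 0 (insert 1 ∅)) (by simp) (by decide) ?_
    exact .cons 0 1 _ (by decide) (by simp) (by simp) (by simp) .nil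
  · intro h
    obtain ⟨f, hf⟩ := h.edge
    exact hf 0

theorem wins_2 : AliceWins (matching 2) (⊤ : SimpleGraph (Fin 5)) := by
  apply Win.aliceWins
  have copy : ∀ (S : Set (Sym2 (Fin 5))) (a b c d : Fin 5), s(a, b) ∈ S → s(c, d) ∈ S →
      a ≠ b → c ≠ d → a ≠ c → a ≠ d → b ≠ c → b ≠ d → HasCopy (matching 2) S := by
    intro S a b c d h1 h2 _ _ _ _ _ _
    have hp : PM S (insert a (insert b (insert c (insert d ∅)))) :=
      .cons a b _ (by tauto) (by simp; tauto) (by simp; tauto) h1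
        (.cons c d _ (by tauto) (by simp) (by simp) h2 .nil)
    obtain ⟨k, hk, f, hf, -, hS⟩ := hp.emb
    have h4 : (insert a (insert b (insert c (insert d (∅ : Finset (Fin 5)))))).card = 4 := by
      rw [Finset.card_insert_of_notMem (by simp; tauto),
        Finset.card_insert_of_notMem (by simp; tauto),
        Finset.card_insert_of_notMem (by simp; tauto),
        Finset.card_insert_of_notMem (by simp)]
      simp
    have : k = 2 := by omega
    subst this
    exact hasCopy_of f hf hS
  refine Win.later _ _ s(0, 1) ⟨by simp, by simp, by simp⟩ ⟨s(2, 3), by simp, by simp, by simp⟩ ?_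
  intro f hf
  have nc : ¬ HasCopy (matching 2) (insert f (∅ : Set (Sym2 (Fin 5)))) := by
    intro h
    obtain ⟨P, hP, hm, -⟩ := h.sub
    have := Set.ncard_le_ncard hP (Set.toFinite _)
    have h2 := Set.ncard_insert_le f (∅ : Set (Sym2 (Fin 5)))
    rw [Set.ncard_empty] at h2
    omega
  by_cases hfe : f = s(2, 3)
  · subst hfe
    refine Win.now _ _ s(2, 4) ⟨by simp, by simp, by simp⟩ ?_ nc
    exact copy _ 0 1 2 4 (by simp) (by simp) (by decide) (by decide) (by decide) (by decide)
      (by decide) (by decide)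
  · refine Win.now _ _ s(2, 3) ⟨by simp, by simp, by simp; exact fun h => hfe h.symm⟩ ?_ nc
    exact copy _ 0 1 2 3 (by simp) (by simp) (by decide) (by decide) (by decide) (by decide)
      (by decide) (by decide)

theorem small {m n : ℕ} (h : AliceWins (matching m) (⊤ : SimpleGraph (Fin n))) : 2 * m ≤ n := by
  classical
  obtain ⟨σ, hσ, h⟩ := h
  obtain ⟨k, -, ⟨f, -⟩, -⟩ := h σ hσ
  have := Fintype.card_le_of_embedding f
  simp at this
  omega

theorem compl_unique : ∀ a b c d g h : Fin 4, a ≠ b → a ≠ c → a ≠ d → b ≠ c → b ≠ d → c ≠ d →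
    g ≠ h → g ≠ a → g ≠ b → h ≠ a → h ≠ b → s(g, h) = s(c, d) := by
  decide

theorem no_four : ¬ AliceWins (matching 2) (⊤ : SimpleGraph (Fin 4)) := by
  classical
  rintro ⟨σ, hσ, h⟩
  let G : SimpleGraph (Fin 4) := ⊤
  let Q : List (Sym2 (Fin 4)) → Sym2 (Fin 4) → Prop := fun l e =>
    e ∈ G.edgeSet ∧ e ∉ l ∧ ∃ e0, l.getLast? = some e0 ∧ ∀ v, v ∈ e → v ∉ e0
  let τ : Strategy (Fin 4) := fun l =>
    if h : ∃ e, Q l e then h.choose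
    else if h : ∃ e ∈ G.edgeSet, e ∉ l then h.choose else s(0, 1)
  have hτQ : ∀ l, (∃ e, Q l e) → Q l (τ l) := by
    intro l h
    simp only [τ, dif_pos h]
    exact h.choose_spec
  have hτ : Strategy.Valid G τ := by
    intro l hl
    by_cases h : ∃ e, Q l e
    · exact ⟨(hτQ l h).1, (hτQ l h).2.1⟩
    · simp only [τ, dif_neg h, dif_pos hl]
      exact hl.choose_spec
  obtain ⟨k, hk, hcp, -⟩ := h τ hτ
  obtain ⟨f, hf⟩ := hcp.edge
  have hcardG : G.edgeSet.ncard = 6 := by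
    have : G.edgeSet = ((⊤ : SimpleGraph (Fin 4)).edgeFinset : Set _) := by simp [G]
    rw [this, Set.ncard_coe_finset]
    decide
  -- Alice cannot own two disjoint edges
  have key : ∀ i j, i < j → j ≤ k → ∀ a b c d : Fin 4, a ≠ b → a ≠ c → a ≠ d → b ≠ c → b ≠ d →
      c ≠ d → move σ τ (2 * i) = s(a, b) → move σ τ (2 * j) = s(c, d) → False := by
    intro i j hij hjk a b c d n1 n2 n3 n4 n5 n6 e1 e2
    have hin : s(c, d) ∈ hist σ τ (2 * i + 2) := by
      by_cases hc : s(c, d) ∈ hist σ τ (2 * i + 1)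
      · rw [hist_succ (n := 2 * i + 1)]; simp [hc]
      · have hlast : (hist σ τ (2 * i + 1)).getLast? = some s(a, b) := by
          rw [hist_succ, e1]; simp
        have hq := hτQ (hist σ τ (2 * i + 1)) ⟨s(c, d), by simpa [G] using n6, hc, s(a, b), hlast, by
          intro v hv hv'; simp at hv hv'; grind⟩
        obtain ⟨q1, q2, e0, q3, q4⟩ := hq
        rw [hlast] at q3
        obtain rfl := Option.some.inj q3
        have hm : τ (hist σ τ (2 * i + 1)) = move σ τ (2 * i + 1) := by
          simp [move]
        have : τ (hist σ τ (2 * i + 1)) = s(c, d) := by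
          generalize τ (hist σ τ (2 * i + 1)) = z at q1 q4
          induction z with
          | _ g h =>
            simp [G] at q1 q4
            exact compl_unique a b c d g h n1 n2 n3 n4 n5 n6 q1 q4.1.1 q4.1.2 q4.2.1 q4.2.2
        rw [← this, hm]
        exact mem_hist _ _ _ _ (by omega)
    have hin2 : s(c, d) ∈ hist σ τ (2 * j) := by
      rw [List.mem_iff_getElem?] at hin ⊢
      obtain ⟨t, ht⟩ := hin
      refine ⟨t, ?_⟩
      rw [hist_get] at ht ⊢
      split_ifs at ht with h'
      rw [if_pos (by omega)]
      exact ht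
    have hfree : ∃ e ∈ G.edgeSet, e ∉ hist σ τ (2 * j) := by
      by_contra hcon
      push Not at hcon
      have hsub : G.edgeSet ⊆ ((hist σ τ (2 * j)).toFinset : Set _) := by
        intro e he; simpa using hcon e he
      have h1 := Set.ncard_le_ncard hsub (Set.toFinite _)
      rw [Set.ncard_coe_finset, hcardG] at h1
      have h2 := List.toFinset_card_le (hist σ τ (2 * j))
      rw [hist_length] at h2
      have h3 : 2 * k + 1 ≤ 6 := by rw [← hcardG]; exact hk
      omega
    have := (hσ _ hfree).2
    have hm : σ (hist σ τ (2 * j)) = move σ τ (2 * j) := by simp [move]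
    rw [hm, e2] at this
    exact this hin2
  obtain ⟨i, hi, ei⟩ := hf 0
  obtain ⟨j, hj, ej⟩ := hf 1
  have ne : ∀ x y, x ≠ y → f x ≠ f y := fun x y h h' => h (f.injective h')
  rcases lt_trichotomy i j with h | h | h
  · exact key i j h hj _ _ _ _ (ne _ _ (by simp)) (ne _ _ (by simp)) (ne _ _ (by simp))
      (ne _ _ (by simp)) (ne _ _ (by simp)) (ne _ _ (by simp)) ei.symm ej.symm
  · subst h
    rw [← ej] at ei
    simp at ei
  · exact key j i h hi _ _ _ _ (ne _ _ (by simp)) (ne _ _ (by simp)) (ne _ _ (by simp))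
      (ne _ _ (by simp)) (ne _ _ (by simp)) (ne _ _ (by simp)) ej.symm ei.symm

end AchievementGame

/-- For every positive integer `m`, the achievement number of the matching `mK₂`
satisfies `a(mK₂) = 5` if `m = 2`, and `a(mK₂) = 2m` if `m = 1` or `m ≥ 3`:
the least `n` for which Alice has a winning strategy in `(mK₂, Kₙ, +)` is that value. -/
theorem stmt0 (m : ℕ) (hm : 1 ≤ m) :
    IsLeast {n : ℕ | AliceWins (matching m) (⊤ : SimpleGraph (Fin n))}
      (if m = 2 then 5 else 2 * m) := by

  constructor
  · show AliceWins _ _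
    by_cases h2 : m = 2
    · subst h2; exact wins_2
    · rw [if_neg h2]
      rcases (by omega : m = 1 ∨ 3 ≤ m) with rfl | h
      · exact wins_1
      · exact wins_ge3 m h
  · intro n hn
    have h := small hn
    split_ifs with h2
    · subst h2
      rcases (by omega : n = 4 ∨ 5 ≤ n) with rfl | h'
      · exact absurd hn no_four
      · exact h'
    · exact h
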